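/- arXiv:0901.3449 — 3 statements merged into one kernel-verified Lean document; each statement's English description precedes it below -/
import Mathlib

section
/- Let d ≥ 1, let T be a measure-preserving ℤ^d-action on a probability space (X,μ), and let f : X → [0,∞) be measurable with ∫₀^∞ (μ{x : f(x) > s})^{1/d} ds < ∞. Then there exists a constant C > 0 such that for all λ ≥ 1: μ({ x ∈ X : sup_{n ≠ 0} (1/|n|)·( f(T_n x) + Σ_{m : 0 < |n−m| ≤ |n|/2} f(T_m x)/|n−m|^{d−1} ) > λ }) ≤ C·( (1/λ)·∫₀^∞ (μ{f > s})^{1/d} ds )^d. -/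
open MeasureTheory
open scoped ENNReal NNReal

/-- The cube of radius `R` centred at `n` in `ℤ^d`. -/
noncomputable def latticeCube {d : ℕ} (n : Fin d → ℤ) (R : ℕ) : Finset (Fin d → ℤ) :=
  Finset.Icc (n - fun _ => (R : ℤ)) (n + fun _ => (R : ℤ))

/-- The sup-norm of a lattice point, truncated below at `1`. -/
def truncSupNorm {d : ℕ} (m : Fin d → ℤ) : ℕ :=
  max 1 (Finset.univ.sup fun i => (m i).natAbs)

lemma mem_latticeCube {d : ℕ} {n m : Fin d → ℤ} {R : ℕ} :
    m ∈ latticeCube n R ↔ ∀ i, |m i - n i| ≤ R := by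
  simp only [latticeCube, Finset.mem_Icc, Pi.le_def, Pi.sub_apply, Pi.add_apply, abs_le]
  constructor
  · rintro ⟨h1, h2⟩ i
    have := h1 i; have := h2 i
    constructor <;> linarith
  · intro h
    constructor <;> intro i <;> have := h i <;> linarith

lemma card_latticeCube {d : ℕ} (n : Fin d → ℤ) (R : ℕ) :
    (latticeCube n R).card = (2 * R + 1) ^ d := by
  have h : ∀ i, (n i + (R : ℤ) + 1 - (n i - R)).toNat = 2 * R + 1 := by intro i; omega
  simp [latticeCube, Pi.card_Icc, h]

lemma coe_latticeCube {d : ℕ} (n : Fin d → ℤ) (R : ℕ) :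
    (latticeCube n R : Set (Fin d → ℤ)) = Metric.closedBall n R := by
  ext m
  rw [Finset.mem_coe, mem_latticeCube, Metric.mem_closedBall, dist_pi_le_iff (by positivity)]
  refine forall_congr' fun i => ?_
  rw [Int.dist_eq]
  exact_mod_cast Iff.rfl

lemma sum_latticeCube_translate {d : ℕ} (n : Fin d → ℤ) (R : ℕ) (g : (Fin d → ℤ) → ℝ≥0∞) :
    ∑ m ∈ latticeCube n R, g m = ∑ m ∈ latticeCube 0 R, g (m + n) := by
  symm
  refine Finset.sum_bij (fun m _ => m + n) ?_ ?_ ?_ ?_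
  · intro m hm
    rw [mem_latticeCube] at hm ⊢
    intro i; simpa using hm i
  · intro a _ b _ h; exact add_right_cancel h
  · intro b hb
    refine ⟨b - n, ?_, by simp⟩
    rw [mem_latticeCube] at hb ⊢
    intro i; simpa using hb i
  · intros; rfl

/-- A finite Vitali-type covering bound for cubes in `ℤ^d`. -/
lemma card_mul_le_sum_of_cube_averages {d : ℕ} (g : (Fin d → ℤ) → ℝ≥0∞) (α : ℝ≥0∞) (L R₀ : ℕ)
    (S : Finset (Fin d → ℤ)) (hS : S ⊆ latticeCube 0 L) (R : (Fin d → ℤ) → ℕ)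
    (hR : ∀ n ∈ S, R n ≤ R₀)
    (hα : ∀ n ∈ S, α * (2 * R n + 1 : ℕ) ^ d ≤ ∑ m ∈ latticeCube n (R n), g m) :
    α * S.card ≤ 5 ^ d * ∑ m ∈ latticeCube 0 (L + R₀), g m := by
  classical
  obtain ⟨u, huS, hdisj, hcov⟩ :=
    Vitali.exists_disjoint_subfamily_covering_enlargement_closedBall (S : Set (Fin d → ℤ))
      (fun n => n) (fun n => (R n : ℝ)) (R₀ : ℝ) (fun n hn => by exact_mod_cast hR n hn)
      5 (by norm_num)
  have hufin : u.Finite := S.finite_toSet.subset huS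
  lift u to Finset (Fin d → ℤ) using hufin
  have huS' : u ⊆ S := by exact_mod_cast huS
  have hsub : S ⊆ u.biUnion fun n => latticeCube n (5 * R n) := by
    intro a ha
    obtain ⟨b, hb, hab⟩ := hcov a ha
    rw [Finset.mem_biUnion]
    refine ⟨b, hb, ?_⟩
    rw [← Finset.mem_coe, coe_latticeCube]
    push_cast
    exact hab (Metric.mem_closedBall_self (by positivity))
  have hcard : S.card ≤ ∑ n ∈ u, 5 ^ d * (2 * R n + 1) ^ d := by
    refine (Finset.card_le_card hsub).trans (Finset.card_biUnion_le.trans ?_)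
    refine Finset.sum_le_sum fun n _ => ?_
    rw [card_latticeCube, ← mul_pow]
    exact Nat.pow_le_pow_left (by omega) d
  have hdisj' : (u : Set (Fin d → ℤ)).PairwiseDisjoint fun n => latticeCube n (R n) := by
    intro a ha b hb hab
    have := hdisj ha hb hab
    simp only [Function.onFun] at this ⊢
    rwa [← coe_latticeCube, ← coe_latticeCube, Finset.disjoint_coe] at this
  calc α * S.card ≤ α * ((∑ n ∈ u, 5 ^ d * (2 * R n + 1) ^ d : ℕ) : ℝ≥0∞) := by
        gcongr
    _ = 5 ^ d * ∑ n ∈ u, α * (2 * R n + 1 : ℕ) ^ d := by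
        push_cast
        rw [Finset.mul_sum, Finset.mul_sum]
        refine Finset.sum_congr rfl fun n _ => by ring
    _ ≤ 5 ^ d * ∑ n ∈ u, ∑ m ∈ latticeCube n (R n), g m := by
        gcongr with n hn
        exact hα n (huS' hn)
    _ = 5 ^ d * ∑ m ∈ u.biUnion fun n => latticeCube n (R n), g m := by
        rw [Finset.sum_biUnion hdisj']
    _ ≤ _ := by
        gcongr
        intro m hm
        obtain ⟨n, hn, hmn⟩ := Finset.mem_biUnion.1 hm
        have h1 := mem_latticeCube.1 (hS (huS' hn))
        have h2 := hR n (huS' hn)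
        rw [mem_latticeCube] at hmn ⊢
        intro i
        have h3 := h1 i
        have h4 := hmn i
        simp only [Pi.zero_apply, sub_zero, abs_le] at h3 h4 ⊢
        push_cast
        omega

lemma tendsto_cube_ratio (d R₀ : ℕ) :
    Filter.Tendsto (fun L : ℕ => ((2 * (L + R₀) + 1 : ℕ) : ℝ≥0∞) ^ d / ((2 * L + 1 : ℕ) : ℝ≥0∞) ^ d)
      Filter.atTop (nhds 1) := by
  have hreal : Filter.Tendsto
      (fun L : ℕ => (((2 * (L + R₀) + 1 : ℕ) : ℝ) / ((2 * L + 1 : ℕ) : ℝ)) ^ d)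
      Filter.atTop (nhds 1) := by
    have h0 : Filter.Tendsto (fun L : ℕ => ((2 * R₀ : ℝ)) / ((2 * L + 1 : ℕ) : ℝ))
        Filter.atTop (nhds 0) := by
      refine Filter.Tendsto.div_atTop tendsto_const_nhds ?_
      refine tendsto_natCast_atTop_atTop.comp ?_
      exact Filter.tendsto_atTop_mono (fun n => by simp only [id]; omega) Filter.tendsto_id
    have h1 : Filter.Tendsto (fun L : ℕ => (1 + (2 * R₀ : ℝ) / ((2 * L + 1 : ℕ) : ℝ)) ^ d)
        Filter.atTop (nhds 1) := by
      simpa using (h0.const_add 1).pow d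
    refine h1.congr fun L => ?_
    congr 1
    have : ((2 * L + 1 : ℕ) : ℝ) ≠ 0 := by positivity
    field_simp
    push_cast
    ring
  have := ENNReal.tendsto_ofReal hreal
  rw [ENNReal.ofReal_one] at this
  refine this.congr fun L => ?_
  rw [ENNReal.ofReal_pow (by positivity), ENNReal.ofReal_div_of_pos (by positivity),
    ENNReal.ofReal_natCast, ENNReal.ofReal_natCast, div_eq_mul_inv, mul_pow, ← ENNReal.inv_pow,
    div_eq_mul_inv]

/-- Weak-type `(1,1)` maximal inequality for cube averages along a `ℤ^d`-action, with bounded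
radii. -/
lemma maximal_inequality_bounded_radius {X : Type*} [MeasurableSpace X] (μ : Measure X)
    [IsFiniteMeasure μ] (d : ℕ) (T : (Fin d → ℤ) → X → X)
    (hTadd : ∀ n m : Fin d → ℤ, T (n + m) = T n ∘ T m)
    (hTmp : ∀ n : Fin d → ℤ, MeasurePreserving (T n) μ μ)
    (h : X → ℝ≥0∞) (hh : Measurable h) (α : ℝ≥0∞) (R₀ : ℕ) :
    α * μ {x | ∃ R ≤ R₀, α * (2 * R + 1 : ℕ) ^ d < ∑ m ∈ latticeCube 0 R, h (T m x)}
      ≤ 5 ^ d * ∫⁻ x, h x ∂μ := by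
  classical
  set E := {x | ∃ R ≤ R₀, α * (2 * R + 1 : ℕ) ^ d < ∑ m ∈ latticeCube 0 R, h (T m x)} with hE
  have hsm : ∀ R : ℕ, Measurable fun x => ∑ m ∈ latticeCube 0 R, h (T m x) := fun R =>
    Finset.measurable_fun_sum _ fun m _ => hh.comp (hTmp m).measurable
  have hEm : MeasurableSet E := by
    have : E = ⋃ R ∈ Set.Iic R₀,
        {x | α * (2 * R + 1 : ℕ) ^ d < ∑ m ∈ latticeCube 0 R, h (T m x)} := by
      ext x; simp [hE]
    rw [this]
    exact MeasurableSet.biUnion (Set.to_countable _)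
      fun R _ => measurableSet_lt measurable_const (hsm R)
  have hpt : ∀ L : ℕ, ∀ x, α * ∑ n ∈ latticeCube 0 L, E.indicator 1 (T n x)
      ≤ 5 ^ d * ∑ m ∈ latticeCube 0 (L + R₀), h (T m x) := by
    intro L x
    have hex : ∀ n : Fin d → ℤ, ∃ R : ℕ, T n x ∈ E → R ≤ R₀ ∧
        α * (2 * R + 1 : ℕ) ^ d ≤ ∑ m ∈ latticeCube n R, h (T m x) := by
      intro n
      by_cases hn : T n x ∈ E
      · obtain ⟨R, hR, hlt⟩ := hn
        refine ⟨R, fun _ => ⟨hR, ?_⟩⟩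
        rw [sum_latticeCube_translate]
        simpa [hTadd] using hlt.le
      · exact ⟨0, fun h => absurd h hn⟩
    choose R hR using hex
    have := card_mul_le_sum_of_cube_averages (fun m => h (T m x)) α L R₀
      ((latticeCube 0 L).filter fun n => T n x ∈ E) (Finset.filter_subset _ _) R
      (fun n hn => (hR n (Finset.mem_filter.1 hn).2).1)
      (fun n hn => (hR n (Finset.mem_filter.1 hn).2).2)
    refine le_trans (le_of_eq ?_) this
    rw [Finset.card_filter]
    simp [Set.indicator_apply]
  have hint : ∀ L : ℕ, ((2 * L + 1 : ℕ) : ℝ≥0∞) ^ d * (α * μ E)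
      ≤ ((2 * (L + R₀) + 1 : ℕ) : ℝ≥0∞) ^ d * (5 ^ d * ∫⁻ x, h x ∂μ) := by
    intro L
    have h1 := lintegral_mono (μ := μ) (hpt L)
    have hi : Measurable (E.indicator (1 : X → ℝ≥0∞)) := measurable_one.indicator hEm
    have him : ∀ m, Measurable fun x => E.indicator (1 : X → ℝ≥0∞) (T m x) :=
      fun m => hi.comp (hTmp m).measurable
    have hhm : ∀ m, Measurable fun x => h (T m x) := fun m => hh.comp (hTmp m).measurable
    rw [lintegral_const_mul _ (Finset.measurable_fun_sum _ fun m _ => him m), lintegral_const_mul _ (hsm _),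
      lintegral_finsetSum _ fun m _ => him m,
      lintegral_finsetSum _ fun m _ => hhm m] at h1
    simp only [(hTmp _).lintegral_comp hi, (hTmp _).lintegral_comp hh, Finset.sum_const,
      card_latticeCube, lintegral_indicator_one hEm, nsmul_eq_mul] at h1
    push_cast at h1 ⊢
    calc _ = _ := by ring
      _ ≤ _ := h1
      _ = _ := by ring
  by_cases hI : 5 ^ d * ∫⁻ x, h x ∂μ = ⊤
  · rw [hI]; exact le_top
  have hlim := ENNReal.Tendsto.mul_const (b := 5 ^ d * ∫⁻ x, h x ∂μ)
    (tendsto_cube_ratio d R₀) (Or.inr hI)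
  rw [one_mul] at hlim
  refine ge_of_tendsto' hlim fun L => ?_
  have hL0 : ((2 * L + 1 : ℕ) : ℝ≥0∞) ^ d ≠ 0 := pow_ne_zero _ (by simp)
  rw [ENNReal.mul_comm_div, ← mul_div_assoc, ENNReal.le_div_iff_mul_le (Or.inl hL0)
    (Or.inl (ENNReal.pow_ne_top (ENNReal.natCast_ne_top _))), mul_comm]
  exact hint L

/-- Weak-type `(1,1)` maximal inequality for cube averages along a `ℤ^d`-action. -/
lemma maximal_inequality_cube_averages {X : Type*} [MeasurableSpace X] (μ : Measure X)
    [IsFiniteMeasure μ] (d : ℕ) (T : (Fin d → ℤ) → X → X)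
    (hTadd : ∀ n m : Fin d → ℤ, T (n + m) = T n ∘ T m)
    (hTmp : ∀ n : Fin d → ℤ, MeasurePreserving (T n) μ μ)
    (h : X → ℝ≥0∞) (hh : Measurable h) (α : ℝ≥0∞) :
    α * μ {x | ∃ R : ℕ, α * (2 * R + 1 : ℕ) ^ d < ∑ m ∈ latticeCube 0 R, h (T m x)}
      ≤ 5 ^ d * ∫⁻ x, h x ∂μ := by
  have hU : {x | ∃ R : ℕ, α * (2 * R + 1 : ℕ) ^ d < ∑ m ∈ latticeCube 0 R, h (T m x)} =
      ⋃ R₀ : ℕ, {x | ∃ R ≤ R₀, α * (2 * R + 1 : ℕ) ^ d < ∑ m ∈ latticeCube 0 R, h (T m x)} := by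
    ext x
    simp only [Set.mem_ofPred_eq, Set.mem_iUnion]
    exact ⟨fun ⟨R, hR⟩ => ⟨R, R, le_rfl, hR⟩, fun ⟨_, R, _, hR⟩ => ⟨R, hR⟩⟩
  have hmono : Monotone fun R₀ : ℕ =>
      {x | ∃ R ≤ R₀, α * (2 * R + 1 : ℕ) ^ d < ∑ m ∈ latticeCube 0 R, h (T m x)} :=
    fun a b hab x ⟨R, hR, hx⟩ => ⟨R, hR.trans hab, hx⟩
  rw [hU, hmono.measure_iUnion, ENNReal.mul_iSup]
  exact iSup_le fun R₀ => maximal_inequality_bounded_radius μ d T hTadd hTmp h hh α R₀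

lemma card_truncSupNorm_eq_le {d : ℕ} (S : Finset (Fin d → ℤ)) {j : ℕ}
    (hj : 1 ≤ j) :
    (S.filter fun m => truncSupNorm m = j).card ≤ (1 + 2 * d) * 3 ^ (d - 1) * j ^ (d - 1) := by
  classical
  have hsub : (S.filter fun m => truncSupNorm m = j) ⊆
      insert 0 (Finset.univ.biUnion fun i : Fin d => Fintype.piFinset
        (Function.update (fun _ => Finset.Icc (-(j : ℤ)) j) i {(j : ℤ), -(j : ℤ)})) := by
    intro m hm
    have hm := (Finset.mem_filter.1 hm).2
    rw [Finset.mem_insert, or_iff_not_imp_left]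
    intro hm0
    obtain ⟨i₀, hi₀⟩ : ∃ i, m i ≠ 0 := by
      by_contra! hc
      exact hm0 (funext hc)
    have hle : ∀ i, (m i).natAbs ≤ j := by
      intro i
      rw [← hm]
      exact le_max_of_le_right
        (Finset.le_sup (f := fun i => (m i).natAbs) (Finset.mem_univ i))
    obtain ⟨i, -, hi⟩ := Finset.exists_mem_eq_sup Finset.univ ⟨i₀, Finset.mem_univ _⟩
      (fun i => (m i).natAbs)
    have h1 := Finset.le_sup (f := fun i => (m i).natAbs) (Finset.mem_univ i₀)
    have hij : (m i).natAbs = j := by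
      simp only [truncSupNorm] at hm
      omega
    rw [Finset.mem_biUnion]
    refine ⟨i, Finset.mem_univ _, ?_⟩
    rw [Fintype.mem_piFinset]
    intro a
    by_cases ha : a = i
    · subst ha
      simp only [Function.update_self, Finset.mem_insert, Finset.mem_singleton]
      omega
    · rw [Function.update_of_ne ha, Finset.mem_Icc]
      have := hle a
      omega
  refine (Finset.card_le_card hsub).trans ((Finset.card_insert_le _ _).trans ?_)
  have hb : ∀ i : Fin d, (Fintype.piFinset (Function.update
      (fun _ => Finset.Icc (-(j : ℤ)) j) i {(j : ℤ), -(j : ℤ)})).card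
      ≤ 2 * (3 ^ (d - 1) * j ^ (d - 1)) := by
    intro i
    rw [Fintype.card_piFinset, ← Finset.mul_prod_erase _ _ (Finset.mem_univ i),
      Function.update_self]
    refine Nat.mul_le_mul Finset.card_le_two ?_
    rw [← mul_pow]
    refine (Finset.prod_le_pow_card _ _ (3 * j) ?_).trans ?_
    · intro a ha
      rw [Function.update_of_ne (Finset.ne_of_mem_erase ha), Int.card_Icc]
      omega
    · rw [Finset.card_erase_of_mem (Finset.mem_univ _), Finset.card_univ, Fintype.card_fin]
  have h2 := (Finset.card_biUnion_le (s := Finset.univ) (t := fun i : Fin d => Fintype.piFinset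
        (Function.update (fun _ => Finset.Icc (-(j : ℤ)) j) i {(j : ℤ), -(j : ℤ)}))).trans
      (Finset.sum_le_sum fun i _ => hb i)
  have h3 : 1 ≤ 3 ^ (d - 1) * j ^ (d - 1) := Nat.mul_pos (by positivity) (by positivity)
  simp only [Finset.sum_const, Finset.card_univ, Fintype.card_fin, smul_eq_mul] at h2
  nlinarith

/-- The kernel `|m|^{1-d}` summed over a ball of radius `ρ` in `ℤ^d` is `O(ρ)`. -/
lemma sum_kernel_le {d : ℕ} (S : Finset (Fin d → ℤ)) (ρ : ℝ≥0∞) (hρ : ρ ≠ ⊤) :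
    ∑ m ∈ S, (if (truncSupNorm m : ℝ≥0∞) ≤ ρ then ((truncSupNorm m : ℝ≥0∞) ^ (d - 1))⁻¹ else 0)
      ≤ ((1 + 2 * d) * 3 ^ (d - 1) : ℕ) * ρ := by
  classical
  lift ρ to ℝ≥0 using hρ
  set c := (1 + 2 * d) * 3 ^ (d - 1)
  rw [← Finset.sum_filter]
  have hmaps : ∀ m ∈ S.filter fun m => (truncSupNorm m : ℝ≥0∞) ≤ ρ,
      truncSupNorm m ∈ Finset.Icc 1 ⌊ρ⌋₊ := by
    intro m hm
    have := (Finset.mem_filter.1 hm).2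
    rw [Finset.mem_Icc]
    refine ⟨le_max_left _ _, Nat.le_floor ?_⟩
    exact_mod_cast this
  rw [← Finset.sum_fiberwise_of_maps_to hmaps]
  calc _ ≤ ∑ j ∈ Finset.Icc 1 ⌊ρ⌋₊, (c : ℝ≥0∞) := by
        refine Finset.sum_le_sum fun j hj => ?_
        have hj1 := (Finset.mem_Icc.1 hj).1
        rw [Finset.sum_congr rfl (g := fun _ => ((j : ℝ≥0∞) ^ (d - 1))⁻¹)
          (fun m hm => by rw [(Finset.mem_filter.1 hm).2]), Finset.sum_const, nsmul_eq_mul,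
          ← div_eq_mul_inv]
        refine ENNReal.div_le_of_le_mul ?_
        exact_mod_cast card_truncSupNorm_eq_le _ hj1
    _ = c * (⌊ρ⌋₊ : ℝ≥0∞) := by
        simp [mul_comm]
    _ ≤ c * ρ := by
        gcongr
        exact_mod_cast Nat.floor_le zero_le

/-- Pointwise bound of a truncated fractional sum by a level-dependent splitting at radius
`a * w t`. -/
lemma sum_mul_kernel_le {d : ℕ} (F : (Fin d → ℤ) → ℝ) (S : Finset (Fin d → ℤ)) (n : Fin d → ℤ)
    (w : ℝ → ℝ≥0∞) (hw : Measurable w) (hw_top : ∀ t, w t ≠ ⊤) (a : ℝ≥0∞) (ha : a ≠ 0)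
    (ha_top : a ≠ ⊤) :
    ∑ m ∈ S, ENNReal.ofReal (F m) * ((truncSupNorm (n - m) : ℝ≥0∞) ^ (d - 1))⁻¹
      ≤ ((1 + 2 * d) * 3 ^ (d - 1) : ℕ) * (a * ∫⁻ t in Set.Ioi (0 : ℝ), w t)
        + (a ^ (d - 1))⁻¹ *
          ∑ m ∈ S, ∫⁻ t in Set.Ioi (0 : ℝ), if t < F m then (w t ^ (d - 1))⁻¹ else 0 := by
  classical
  set c : ℕ := (1 + 2 * d) * 3 ^ (d - 1)
  have hv : ∀ y : ℝ, Measurable fun t => if t < y then (w t ^ (d - 1))⁻¹ else 0 := fun y =>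
    Measurable.ite measurableSet_Iio (hw.pow_const _).inv measurable_const
  have hk : ∀ k : ℝ≥0∞, Measurable fun t => if k ≤ a * w t then (k ^ (d - 1))⁻¹ else 0 := fun k =>
    Measurable.ite (measurableSet_le measurable_const (hw.const_mul a)) measurable_const
      measurable_const
  have hlayer : ∀ (y : ℝ) (K : ℝ≥0∞), ENNReal.ofReal y * K
      = ∫⁻ t in Set.Ioi (0 : ℝ), if t < y then K else 0 := by
    intro y K
    have : (fun t : ℝ => if t < y then K else 0) = (Set.Iio y).indicator fun _ => K := by
      ext t; simp [Set.indicator_apply]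
    rw [this, lintegral_indicator measurableSet_Iio, setLIntegral_const,
      Measure.restrict_apply measurableSet_Iio, Set.inter_comm, Set.Ioi_inter_Iio,
      Real.volume_Ioo, sub_zero, mul_comm]
  have hpt : ∀ (k : ℝ≥0∞) (y t : ℝ), (if t < y then (k ^ (d - 1))⁻¹ else 0)
      ≤ (if k ≤ a * w t then (k ^ (d - 1))⁻¹ else 0)
        + (a ^ (d - 1))⁻¹ * (if t < y then (w t ^ (d - 1))⁻¹ else 0) := by
    intro k y t
    by_cases hy : t < y
    · by_cases hkt : k ≤ a * w t
      · simp [hy, hkt]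
      · simp only [hy, hkt, if_true, if_false, zero_add]
        rw [← ENNReal.mul_inv (Or.inl (pow_ne_zero _ ha)) (Or.inl (ENNReal.pow_ne_top ha_top)),
          ← mul_pow]
        gcongr
        exact (not_le.1 hkt).le
    · simp [hy]
  calc _ = ∑ m ∈ S, ∫⁻ t in Set.Ioi (0 : ℝ),
        if t < F m then ((truncSupNorm (n - m) : ℝ≥0∞) ^ (d - 1))⁻¹ else 0 :=
        Finset.sum_congr rfl fun m _ => hlayer _ _
    _ ≤ ∑ m ∈ S, ∫⁻ t in Set.Ioi (0 : ℝ),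
        ((if (truncSupNorm (n - m) : ℝ≥0∞) ≤ a * w t
            then ((truncSupNorm (n - m) : ℝ≥0∞) ^ (d - 1))⁻¹ else 0)
          + (a ^ (d - 1))⁻¹ * (if t < F m then (w t ^ (d - 1))⁻¹ else 0)) :=
        Finset.sum_le_sum fun m _ => lintegral_mono fun t => hpt _ _ _
    _ = (∫⁻ t in Set.Ioi (0 : ℝ), ∑ m ∈ S, if (truncSupNorm (n - m) : ℝ≥0∞) ≤ a * w t
            then ((truncSupNorm (n - m) : ℝ≥0∞) ^ (d - 1))⁻¹ else 0)
        + (a ^ (d - 1))⁻¹ *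
          ∑ m ∈ S, ∫⁻ t in Set.Ioi (0 : ℝ), if t < F m then (w t ^ (d - 1))⁻¹ else 0 := by
        rw [lintegral_finsetSum _ fun m _ => hk _, Finset.mul_sum, ← Finset.sum_add_distrib]
        refine Finset.sum_congr rfl fun m _ => ?_
        rw [lintegral_add_left (hk _), lintegral_const_mul _ (hv _)]
    _ ≤ _ := by
        gcongr
        rw [← lintegral_const_mul _ hw, ← lintegral_const_mul _ (hw.const_mul a)]
        refine lintegral_mono fun t => ?_
        have := sum_kernel_le (S.image fun m => n - m) (a * w t)
          (ENNReal.mul_ne_top ha_top (hw_top t))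
        rwa [Finset.sum_image fun x _ y _ h => sub_right_injective h] at this

lemma lintegral_weighted_layer_le {X : Type*} [MeasurableSpace X] (μ : Measure X)
    [IsFiniteMeasure μ] (d : ℕ) (hd : 1 ≤ d) (f : X → ℝ) (hf : Measurable f) (w : ℝ → ℝ≥0∞)
    (hw : Measurable w) (hw_pow : ∀ t, w t ^ d = μ {x | t < f x}) :
    ∫⁻ x, (∫⁻ t in Set.Ioi (0 : ℝ), if t < f x then (w t ^ (d - 1))⁻¹ else 0) ∂μ
      ≤ ∫⁻ t in Set.Ioi (0 : ℝ), w t := by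
  rw [lintegral_lintegral_swap]
  · refine lintegral_mono fun t => ?_
    have hset : MeasurableSet {x | t < f x} := measurableSet_lt measurable_const hf
    have : (fun x => if t < f x then (w t ^ (d - 1))⁻¹ else 0)
        = {x | t < f x}.indicator fun _ => (w t ^ (d - 1))⁻¹ := by
      ext x; simp [Set.indicator_apply]
    simp only [this]
    rw [lintegral_indicator hset, setLIntegral_const, ← hw_pow]
    obtain ⟨e, rfl⟩ : ∃ e, d = e + 1 := ⟨d - 1, by omega⟩
    rw [Nat.add_sub_cancel, pow_succ, ← mul_assoc]
    exact mul_le_of_le_one_left' (ENNReal.inv_mul_le_one _)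
  · refine Measurable.aemeasurable ?_
    exact Measurable.ite (measurableSet_lt measurable_snd (hf.comp measurable_fst))
      ((hw.comp measurable_snd).pow_const _).inv measurable_const

lemma measurable_weighted_layer {X : Type*} [MeasurableSpace X] (d : ℕ) (f : X → ℝ)
    (hf : Measurable f) (w : ℝ → ℝ≥0∞) (hw : Measurable w) :
    Measurable fun x => ∫⁻ t in Set.Ioi (0 : ℝ), if t < f x then (w t ^ (d - 1))⁻¹ else 0 := by
  refine Measurable.lintegral_prod_right' (f := fun p : X × ℝ =>
    if p.2 < f p.1 then (w p.2 ^ (d - 1))⁻¹ else 0) ?_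
  exact Measurable.ite (measurableSet_lt measurable_snd (hf.comp measurable_fst))
    ((hw.comp measurable_snd).pow_const _).inv measurable_const

lemma sum_abs_cast_eq {d : ℕ} (m : Fin d → ℤ) :
    ∑ k, |(m k : ℝ)| = ((∑ k, (m k).natAbs : ℕ) : ℝ) := by
  push_cast
  exact Finset.sum_congr rfl fun k _ => by simp [Nat.cast_natAbs]

lemma truncSupNorm_le_sum {d : ℕ} {m : Fin d → ℤ} (hm : m ≠ 0) :
    truncSupNorm m ≤ ∑ k, (m k).natAbs := by
  obtain ⟨i, hi⟩ : ∃ i, m i ≠ 0 := by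
    by_contra! hc
    exact hm (funext hc)
  have hle : ∀ i, (m i).natAbs ≤ ∑ k, (m k).natAbs := fun i =>
    Finset.single_le_sum (f := fun k => (m k).natAbs) (fun _ _ => Nat.zero_le _)
      (Finset.mem_univ i)
  refine max_le ?_ (Finset.sup_le fun i _ => hle i)
  have := hle i
  omega

/-- The singular sum at `n` is dominated by a finite sum over a cube. -/
lemma singular_sum_le {d : ℕ} (F : (Fin d → ℤ) → ℝ) (hF : ∀ m, 0 ≤ F m) (n : Fin d → ℤ) :
    F n + ∑' m : Fin d → ℤ, Set.indicator
        {m : Fin d → ℤ | m ≠ n ∧ 2 * (∑ k, |((n - m) k : ℝ)|) ≤ ∑ k, |(n k : ℝ)|}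
        (fun m => F m / (∑ k, |((n - m) k : ℝ)|) ^ (d - 1)) m
      ≤ ∑ m ∈ latticeCube 0 (2 * ∑ k, (n k).natAbs),
          F m * ((truncSupNorm (n - m) : ℝ) ^ (d - 1))⁻¹ := by
  classical
  set r := ∑ k, (n k).natAbs with hr
  have hnr : ∀ i, (n i).natAbs ≤ r := fun i =>
    Finset.single_le_sum (f := fun k => (n k).natAbs) (fun _ _ => Nat.zero_le _)
      (Finset.mem_univ i)
  have hnmem : n ∈ latticeCube 0 (2 * r) := by
    rw [mem_latticeCube]
    intro i
    have := hnr i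
    simp only [Pi.zero_apply, sub_zero, abs_le]
    omega
  have hn1 : (truncSupNorm (n - n) : ℝ) = 1 := by
    simp [truncSupNorm]
  rw [← Finset.add_sum_erase _ _ hnmem, hn1, one_pow, inv_one, mul_one]
  gcongr
  rw [tsum_eq_sum (s := (latticeCube 0 (2 * r)).erase n)]
  · refine Finset.sum_le_sum fun m hm => ?_
    have hmn : n - m ≠ 0 := sub_ne_zero.2 (Finset.ne_of_mem_erase hm).symm
    have h0 : 0 ≤ F m * ((truncSupNorm (n - m) : ℝ) ^ (d - 1))⁻¹ :=
      mul_nonneg (hF m) (by positivity)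
    refine Set.indicator_apply_le' (fun _ => ?_) fun _ => h0
    have h1 : 1 ≤ truncSupNorm (n - m) := le_max_left _ _
    rw [sum_abs_cast_eq, div_eq_mul_inv]
    have := truncSupNorm_le_sum hmn
    have := hF m
    gcongr
  · intro m hm
    refine Set.indicator_of_notMem (fun hmem => hm ?_) _
    obtain ⟨hne, hle⟩ := hmem
    rw [Finset.mem_erase, mem_latticeCube]
    refine ⟨hne, fun i => ?_⟩
    rw [sum_abs_cast_eq, sum_abs_cast_eq] at hle
    have hle' : 2 * ∑ k, ((n - m) k).natAbs ≤ r := by exact_mod_cast hle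
    have h1 := hnr i
    have h2 := Finset.single_le_sum (f := fun k => ((n - m) k).natAbs) (fun _ _ => Nat.zero_le _)
      (Finset.mem_univ i)
    simp only [Pi.sub_apply, Pi.zero_apply, sub_zero, abs_le] at h2 hle' ⊢
    push_cast
    omega

/-- Weak-type bound with a free splitting parameter `θ`. -/
lemma singular_maximal_weak_type_of_split
    {X : Type*} [MeasurableSpace X] (μ : Measure X) [IsFiniteMeasure μ]
    (d : ℕ) (hd : 1 ≤ d)
    (T : (Fin d → ℤ) → X → X)
    (hTadd : ∀ n m : Fin d → ℤ, T (n + m) = T n ∘ T m)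
    (hTmp : ∀ n : Fin d → ℤ, MeasurePreserving (T n) μ μ)
    (f : X → ℝ) (hf_nonneg : ∀ x, 0 ≤ f x) (hf_meas : Measurable f)
    (N : ℝ)
    (hN : ∫⁻ t in Set.Ioi (0 : ℝ), (μ {x | t < f x}) ^ (1 / (d : ℝ)) = ENNReal.ofReal N)
    (lam θ : ℝ) (hlam : 0 < lam) (hθ : 0 < θ)
    (hsplit : ((1 + 2 * d) * 3 ^ (d - 1) : ℕ) * (θ * N) ≤ lam / 2) :
    μ {x | ENNReal.ofReal lam <
          ⨆ n : {n : Fin d → ℤ // n ≠ 0},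
            ENNReal.ofReal ((1 / ∑ k, |(n.1 k : ℝ)|) *
              (f (T n.1 x) +
                ∑' m : Fin d → ℤ,
                  Set.indicator
                    {m : Fin d → ℤ | m ≠ n.1 ∧
                      2 * (∑ k, |((n.1 - m) k : ℝ)|) ≤ ∑ k, |(n.1 k : ℝ)|}
                    (fun m => f (T m x) / (∑ k, |((n.1 - m) k : ℝ)|) ^ (d - 1)) m))} ≤
      ENNReal.ofReal (5 ^ d * N / (lam / 2 * θ ^ (d - 1) / 6 ^ d)) := by
  set c : ℕ := (1 + 2 * d) * 3 ^ (d - 1)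
  set w : ℝ → ℝ≥0∞ := fun t => (μ {x | t < f x}) ^ (1 / (d : ℝ)) with hwdef
  have hd0 : (d : ℝ) ≠ 0 := by positivity
  have hw_anti : Antitone w := fun s t hst =>
    ENNReal.rpow_le_rpow (measure_mono fun x (hx : t < f x) => hst.trans_lt hx) (by positivity)
  have hw : Measurable w := hw_anti.measurable
  have hw_top : ∀ t, w t ≠ ⊤ := fun t =>
    ENNReal.rpow_ne_top_of_nonneg (by positivity) (measure_ne_top _ _)
  have hw_pow : ∀ t, w t ^ d = μ {x | t < f x} := fun t => by
    rw [hwdef, ← ENNReal.rpow_natCast, ← ENNReal.rpow_mul, one_div_mul_cancel hd0,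
      ENNReal.rpow_one]
  set h : X → ℝ≥0∞ := fun x =>
    ∫⁻ t in Set.Ioi (0 : ℝ), if t < f x then (w t ^ (d - 1))⁻¹ else 0 with hh
  have hh_meas : Measurable h := measurable_weighted_layer d f hf_meas w hw
  have hh_int : ∫⁻ x, h x ∂μ ≤ ENNReal.ofReal N :=
    (lintegral_weighted_layer_le μ d hd f hf_meas w hw hw_pow).trans hN.le
  set α : ℝ := lam / 2 * θ ^ (d - 1) / 6 ^ d with hα
  have hα_pos : 0 < α := by positivity
  have hmax := maximal_inequality_cube_averages μ d T hTadd hTmp h hh_meas (ENNReal.ofReal α)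
  rw [ENNReal.ofReal_div_of_pos hα_pos, ENNReal.le_div_iff_mul_le (by simp [hα_pos]) (by simp),
    mul_comm]
  have hrhs : ENNReal.ofReal (5 ^ d * N) = 5 ^ d * ENNReal.ofReal N := by
    rw [ENNReal.ofReal_mul (by positivity), ENNReal.ofReal_pow (by norm_num)]
    norm_num
  rw [hrhs]
  refine le_trans ?_ (hmax.trans (mul_le_mul_right hh_int _))
  refine mul_le_mul_right (measure_mono fun x hx => ?_) _
  obtain ⟨⟨n, hn⟩, hlt⟩ := lt_iSup_iff.1 (show ENNReal.ofReal lam < _ from hx)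
  set r := ∑ k, (n k).natAbs with hr
  have hr1 : 1 ≤ r := (le_max_left _ _).trans (truncSupNorm_le_sum hn)
  refine ⟨2 * r, ?_⟩
  have hr0 : (r : ℝ≥0∞) ≠ 0 := by simp; omega
  have hsum := singular_sum_le (fun m => f (T m x)) (fun m => hf_nonneg _) n
  have hlt2 : ENNReal.ofReal lam < (r : ℝ≥0∞)⁻¹ * ∑ m ∈ latticeCube 0 (2 * r),
      ENNReal.ofReal (f (T m x)) * ((truncSupNorm (n - m) : ℝ≥0∞) ^ (d - 1))⁻¹ := by
    refine hlt.trans_le ?_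
    simp only [sum_abs_cast_eq n]
    rw [ENNReal.ofReal_mul (by positivity), one_div, ENNReal.ofReal_inv_of_pos (by positivity),
      ENNReal.ofReal_natCast]
    gcongr
    rw [sum_abs_cast_eq n] at hsum
    refine (ENNReal.ofReal_le_ofReal hsum).trans (le_of_eq ?_)
    rw [ENNReal.ofReal_sum_of_nonneg fun m _ => mul_nonneg (hf_nonneg _) (by positivity)]
    refine Finset.sum_congr rfl fun m _ => ?_
    have h1 : 1 ≤ truncSupNorm (n - m) := le_max_left _ _
    rw [ENNReal.ofReal_mul (hf_nonneg _), ENNReal.ofReal_inv_of_pos (by positivity),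
      ENNReal.ofReal_pow (by positivity), ENNReal.ofReal_natCast]
  have hθ0 : ENNReal.ofReal θ ≠ 0 := by simp [hθ]
  have hk := sum_mul_kernel_le (fun m => f (T m x)) (latticeCube 0 (2 * r)) n w hw hw_top
    (ENNReal.ofReal θ * r) (mul_ne_zero hθ0 hr0)
    (ENNReal.mul_ne_top ENNReal.ofReal_ne_top (ENNReal.natCast_ne_top _))
  rw [hN] at hk
  set H := ∑ m ∈ latticeCube 0 (2 * r), h (T m x)
  have hfirst : (r : ℝ≥0∞)⁻¹ * (c * (ENNReal.ofReal θ * r * ENNReal.ofReal N))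
      ≤ ENNReal.ofReal (lam / 2) := by
    calc _ = ((r : ℝ≥0∞)⁻¹ * r) * (c * (ENNReal.ofReal θ * ENNReal.ofReal N)) := by ring
      _ = ENNReal.ofReal (c * (θ * N)) := by
        rw [ENNReal.inv_mul_cancel hr0 (ENNReal.natCast_ne_top _), one_mul,
          ENNReal.ofReal_mul (by positivity), ENNReal.ofReal_mul hθ.le, ENNReal.ofReal_natCast]
      _ ≤ _ := ENNReal.ofReal_le_ofReal hsplit
  have hlt3 : ENNReal.ofReal lam < ENNReal.ofReal (lam / 2)
      + (r : ℝ≥0∞)⁻¹ * (((ENNReal.ofReal θ * r) ^ (d - 1))⁻¹ * H) := by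
    refine hlt2.trans_le ((mul_le_mul_right hk _).trans ?_)
    rw [mul_add]
    gcongr
  have hhalf : ENNReal.ofReal lam = ENNReal.ofReal (lam / 2) + ENNReal.ofReal (lam / 2) := by
    rw [← ENNReal.ofReal_add (by positivity) (by positivity), add_halves]
  rw [hhalf, ENNReal.add_lt_add_iff_left ENNReal.ofReal_ne_top] at hlt3
  have hpow_ne : (r : ℝ≥0∞) * (ENNReal.ofReal θ * r) ^ (d - 1) ≠ 0 :=
    mul_ne_zero hr0 (pow_ne_zero _ (mul_ne_zero hθ0 hr0))
  have hpow_top : (r : ℝ≥0∞) * (ENNReal.ofReal θ * r) ^ (d - 1) ≠ ⊤ :=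
    ENNReal.mul_ne_top (ENNReal.natCast_ne_top _) (ENNReal.pow_ne_top
      (ENNReal.mul_ne_top ENNReal.ofReal_ne_top (ENNReal.natCast_ne_top _)))
  rw [← mul_assoc, ← ENNReal.mul_inv (Or.inl hr0) (Or.inl (ENNReal.natCast_ne_top _)), mul_comm,
    ← div_eq_mul_inv, ENNReal.lt_div_iff_mul_lt (Or.inl hpow_ne) (Or.inl hpow_top)] at hlt3
  refine lt_of_le_of_lt ?_ hlt3
  have hreal : α * (2 * (2 * r : ℕ) + 1 : ℕ) ^ d ≤ lam / 2 * (r * (θ * r) ^ (d - 1)) := by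
    have hr1' : (1 : ℝ) ≤ r := by exact_mod_cast hr1
    have h6 : ((2 * (2 * r : ℕ) + 1 : ℕ) : ℝ) ^ d ≤ 6 ^ d * (r : ℝ) ^ d := by
      rw [← mul_pow]
      gcongr
      push_cast
      linarith
    have hrd : (r : ℝ) ^ d = r * r ^ (d - 1) := (mul_pow_sub_one (by omega) _).symm
    calc _ ≤ α * (6 ^ d * (r : ℝ) ^ d) := by gcongr
      _ = _ := by
        rw [hα, hrd, mul_pow]
        field_simp
  have := ENNReal.ofReal_le_ofReal hreal
  rw [ENNReal.ofReal_mul hα_pos.le, ENNReal.ofReal_mul (by positivity),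
    ENNReal.ofReal_mul (by positivity), ENNReal.ofReal_pow (by positivity),
    ENNReal.ofReal_pow (by positivity), ENNReal.ofReal_mul hθ.le, ENNReal.ofReal_natCast,
    ENNReal.ofReal_natCast] at this
  exact this

/-- Maximal inequality for the singular part: if
`f ∈ L^{d,1}(X,μ)` then the maximal function
`sup_{n ≠ 0} (1/|n|)(f(T_n x) + Σ_{0 < |n-m| ≤ |n|/2} f(T_m x)/|n-m|^{d-1})`
satisfies a weak-type `(d,1)` bound. -/
theorem statement7
    {X : Type*} [MeasurableSpace X] (μ : Measure X) [IsProbabilityMeasure μ]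
    (d : ℕ) (hd : 1 ≤ d)
    (T : (Fin d → ℤ) → X → X)
    (hT0 : T 0 = id)
    (hTadd : ∀ n m : Fin d → ℤ, T (n + m) = T n ∘ T m)
    (hTmp : ∀ n : Fin d → ℤ, MeasurePreserving (T n) μ μ)
    (f : X → ℝ)
    (hf_nonneg : ∀ x, 0 ≤ f x)
    (hf_meas : Measurable f)
    (N : ℝ) (hN0 : 0 ≤ N)
    (hN : ∫⁻ t in Set.Ioi (0 : ℝ), (μ {x | t < f x}) ^ (1 / (d : ℝ))
      = ENNReal.ofReal N) :
    ∃ C : ℝ, 0 < C ∧ ∀ lam : ℝ, 1 ≤ lam →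
      μ {x | ENNReal.ofReal lam <
          ⨆ n : {n : Fin d → ℤ // n ≠ 0},
            ENNReal.ofReal ((1 / ∑ k, |(n.1 k : ℝ)|) *
              (f (T n.1 x) +
                ∑' m : Fin d → ℤ,
                  Set.indicator
                    {m : Fin d → ℤ | m ≠ n.1 ∧
                      2 * (∑ k, |((n.1 - m) k : ℝ)|) ≤ ∑ k, |(n.1 k : ℝ)|}
                    (fun m => f (T m x) / (∑ k, |((n.1 - m) k : ℝ)|) ^ (d - 1)) m))} ≤
        ENNReal.ofReal (C * (N / lam) ^ d) := by
  have hc : 0 < (((1 + 2 * d) * 3 ^ (d - 1) : ℕ) : ℝ) := by positivity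
  set c : ℝ := (((1 + 2 * d) * 3 ^ (d - 1) : ℕ) : ℝ)
  refine ⟨60 ^ d * c ^ (d - 1), by positivity, fun lam hlam => ?_⟩
  have hlam0 : 0 < lam := by linarith
  rcases hN0.eq_or_lt with hN_zero | hN_pos
  · subst hN_zero
    refine (singular_maximal_weak_type_of_split μ d hd T hTadd hTmp f hf_nonneg hf_meas 0 hN lam 1
      hlam0 one_pos (by simp only [mul_zero]; positivity)).trans (le_of_eq ?_)
    simp [show d ≠ 0 by omega]
  · refine (singular_maximal_weak_type_of_split μ d hd T hTadd hTmp f hf_nonneg hf_meas N hN lam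
      (lam / (2 * c * N)) hlam0 (by positivity) (le_of_eq ?_)).trans (le_of_eq ?_)
    · change c * _ = _
      field_simp
    · congr 1
      obtain ⟨e, rfl⟩ : ∃ e, d = e + 1 := ⟨d - 1, by omega⟩
      rw [Nat.add_sub_cancel, show (60 : ℝ) = 5 * 6 * 2 by norm_num]
      simp only [mul_pow, div_pow, pow_succ]
      field_simp
end

section
/- (Kingman decomposition.) Let (X,𝔉,μ) be a standard probability space with an ergodic measure-preserving ℤ-action T, let B be a separable real Banach space which is reflexive (the canonical isometric inclusion of B into its double dual is surjective), let c be an isometric cocycle over (X,μ,T) with values in B, and let s be a strongly measurable additive equivariant cocycle on X × ℤ × ℤ with values in B relative to c, with ∫_X ‖s_x(0,n)‖ dμ(x) < ∞ for all n. Define the random semimetric ρ_x(m,n) = ‖s_x(m,n)‖ and let A = lim_{n→∞} (1/n)∫_X ρ_x(0,n) dμ(x) (the drift; the limit exists by subadditivity). Then there exists an integrable function φ : X → ℝ with ∫_X φ dμ = A such that, setting r_n(x) = ρ_x(0,n) − Σ_{k=0}^{n−1} φ(T_k x) for n ≥ 1: r_n(x) ≥ 0 for all n ≥ 1 and almost every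 x; r is subadditive, i.e., r_{n+m}(x) ≤ r_n(x) + r_m(T_n x) for all n,m ≥ 1 and almost every x; and lim_{n→∞} (1/n)∫_X r_n(x) dμ(x) = 0. -/
open MeasureTheory Filter

/-- A dominated sequence of integrable functions converges weakly along every ultrafilter:
its integrals over measurable sets converge to those of some integrable function. -/
lemma exists_integrable_tendsto_setIntegral {X : Type*} [MeasurableSpace X] {μ : Measure X}
    [SigmaFinite μ] {f : ℕ → X → ℝ} {w : X → ℝ} (hw : Integrable w μ)
    (hf : ∀ n, Integrable (f n) μ) (hb : ∀ n x, |f n x| ≤ w x) (U : Ultrafilter ℕ) :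
    ∃ φ : X → ℝ, Integrable φ μ ∧ ∀ E, MeasurableSet E →
      Tendsto (fun n => ∫ x in E, f n x ∂μ) U (nhds (∫ x in E, φ x ∂μ)) := by
  classical
  have hbound : ∀ n E, |∫ x in E, f n x ∂μ| ≤ ∫ x in E, w x ∂μ := fun n E => by
    rw [← Real.norm_eq_abs]
    exact norm_integral_le_of_norm_le hw.integrableOn (ae_of_all _ (hb n))
  have hlim : ∀ E, ∃ l, Tendsto (fun n => ∫ x in E, f n x ∂μ) U (nhds l) := fun E => by
    obtain ⟨l, -, hl⟩ := (isCompact_Icc (a := -∫ x in E, w x ∂μ)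
      (b := ∫ x in E, w x ∂μ)).ultrafilter_le_nhds (U.map fun n => ∫ x in E, f n x ∂μ)
      (le_principal_iff.2 (Filter.mem_map.2 (univ_mem' fun n => abs_le.1 (hbound n E))))
    exact ⟨l, hl⟩
  choose L hL using hlim
  have hL_zero : ∀ E, μ E = 0 → L E = 0 := fun E hE => by
    refine tendsto_nhds_unique (hL E) ?_
    simp [Measure.restrict_eq_zero.2 hE]
  let ν : SignedMeasure X :=
    { measureOf' := fun E => if MeasurableSet E then L E else 0
      empty' := by simp [hL_zero]
      not_measurable' := fun E hE => by simp [hE]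
      m_iUnion' := fun E hE hdisj => by
        have hsum : Summable fun i => ∫ x in E i, w x ∂μ :=
          (hasSum_integral_iUnion hE hdisj hw.integrableOn).summable
        have hLsum : Summable fun i => L (E i) :=
          Summable.of_norm_bounded hsum fun i =>
            le_of_tendsto (hL (E i)).norm (Eventually.of_forall fun n => hbound n (E i))
        simp only [hE, MeasurableSet.iUnion hE, if_true]
        have h := tendsto_tsum_of_dominated_convergence hsum (fun i => hL (E i))
          (Eventually.of_forall fun n i => hbound n (E i))
        simp only [fun n => (hasSum_integral_iUnion hE hdisj (hf n).integrableOn).tsum_eq] at h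
        rw [tendsto_nhds_unique (hL _) h]
        exact hLsum.hasSum }
  have hν : ∀ E, MeasurableSet E → ν E = L E := fun E hE => if_pos hE
  have hac : ν ≪ᵥ μ.toENNRealVectorMeasure := by
    refine VectorMeasure.AbsolutelyContinuous.mk fun E hE hμE => ?_
    rw [Measure.toENNRealVectorMeasure_apply_measurable hE] at hμE
    rw [hν E hE, hL_zero E hμE]
  refine ⟨ν.rnDeriv μ, SignedMeasure.integrable_rnDeriv ν μ, fun E hE => ?_⟩
  have h := congrArg (fun m : SignedMeasure X => m E)
    (SignedMeasure.absolutelyContinuous_iff_withDensityᵥ_rnDeriv_eq ν μ |>.1 hac)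
  simp only [withDensityᵥ_apply (SignedMeasure.integrable_rnDeriv ν μ) hE, hν E hE] at h
  rw [h]
  exact hL E

lemma sum_range_shift_le {F : ℕ → ℝ} {C : ℝ} (hF : ∀ k, |F k| ≤ C) (N j : ℕ) :
    ∑ k ∈ Finset.range N, F (k + j) ≤ ∑ k ∈ Finset.range N, F k + 2 * j * C := by
  induction j with
  | zero => simp
  | succ j ih =>
    have h1 := Finset.sum_range_succ (fun k => F (k + j)) N
    have h2 := Finset.sum_range_succ' (fun k => F (k + j)) N
    have h3 : ∑ k ∈ Finset.range N, F (k + 1 + j) = ∑ k ∈ Finset.range N, F (k + (j + 1)) :=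
      Finset.sum_congr rfl fun k _ => by congr 1; ring
    have h4 := abs_le.1 (hF (N + j))
    have h5 := abs_le.1 (hF (0 + j))
    push_cast
    linarith [h4.2, h5.1]

/-- Kingman decomposition for a random semimetric over a `ℤ`-action: the Birkhoff sums of some
integrable function with mean the drift are dominated by the semimetric. -/
lemma exists_birkhoff_minorant {X : Type*} [MeasurableSpace X] {μ : Measure X}
    [IsProbabilityMeasure μ] {T : ℤ → X → X} (hT0 : T 0 = id)
    (hTadd : ∀ n m : ℤ, T (n + m) = T n ∘ T m) (hTmp : ∀ n : ℤ, MeasurePreserving (T n) μ μ)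
    {ρ : X → ℤ → ℤ → ℝ} (hself : ∀ x m, ρ x m m = 0) (hsymm : ∀ x m n, ρ x m n = ρ x n m)
    (htri : ∀ x m k n, ρ x m n ≤ ρ x m k + ρ x k n)
    (hequiv : ∀ x k m n, ρ (T k x) m n = ρ x (m + k) (n + k))
    (hint : ∀ n : ℤ, Integrable (fun x => ρ x 0 n) μ) {A : ℝ}
    (hA : Tendsto (fun n : ℕ => (∫ x, ρ x 0 (n : ℤ) ∂μ) / n) atTop (nhds A)) :
    ∃ φ : X → ℝ, Integrable φ μ ∧ (∫ x, φ x ∂μ) = A ∧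
      ∀ n : ℕ, ∀ᵐ x ∂μ, ∑ j ∈ Finset.range n, φ (T (j : ℤ) x) ≤ ρ x 0 (n : ℤ) := by
  have hemb : ∀ n, MeasurableEmbedding (T n) := fun n =>
    (MeasurableEquiv.mk
      ⟨T n, T (-n), fun x => by simpa [hT0] using (congrFun (hTadd (-n) n) x).symm,
        fun x => by simpa [hT0] using (congrFun (hTadd n (-n)) x).symm⟩
      (hTmp n).measurable (hTmp (-n)).measurable).measurableEmbedding
  have hset : ∀ (g : X → ℝ) (j : ℤ) (E : Set X),
      ∫ x in E, g (T j x) ∂μ = ∫ x in T (-j) ⁻¹' E, g x ∂μ := fun g j E => by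
    rw [← (hTmp j).setIntegral_preimage_emb (hemb j) g, ← Set.preimage_comp, ← hTadd]
    simp [hT0]
  have hcomp : ∀ {g : X → ℝ} (j : ℤ), Integrable g μ → Integrable (fun x => g (T j x)) μ :=
    fun j hg => (hTmp j).integrable_comp_of_integrable hg
  have hρ : ∀ x (k : ℤ), ρ x 1 (k + 1) = ρ (T 1 x) 0 k := fun x k => by simp [hequiv]
  have hint1 : ∀ k : ℤ, Integrable (fun x => ρ x 1 (k + 1)) μ := fun k => by
    simp only [hρ]
    exact hcomp 1 (hint k)
  have hdiff : ∀ x j k, |ρ x j k - ρ x (j + 1) k| ≤ ρ x j (j + 1) := fun x j k => by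
    have h1 := htri x j (j + 1) k
    have h2 := htri x (j + 1) j k
    rw [hsymm x (j + 1) j] at h2
    exact abs_le.2 ⟨by linarith, by linarith⟩
  let g : ℕ → X → ℝ := fun k x => ρ x 0 (k + 1) - ρ x 1 (k + 1)
  let f : ℕ → X → ℝ := fun N x => (∑ k ∈ Finset.range N, g k x) / N
  have hg : ∀ k, Integrable (g k) μ := fun k => (hint _).sub (hint1 _)
  have hf : ∀ N, Integrable (f N) μ := fun N =>
    (integrable_finsetSum _ fun k _ => hg k).div_const _
  have hw0 : ∀ x, 0 ≤ ρ x 0 1 := fun x => (abs_nonneg _).trans (hdiff x 0 0)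
  have hfb : ∀ N x, |f N x| ≤ ρ x 0 1 := fun N x => by
    have h : |∑ k ∈ Finset.range N, g k x| ≤ N * ρ x 0 1 := by
      refine (Finset.abs_sum_le_sum_abs _ _).trans ?_
      refine (Finset.sum_le_card_nsmul _ _ (ρ x 0 1) fun k _ => ?_).trans (by simp)
      simpa using hdiff x 0 (k + 1)
    rw [abs_div, Nat.abs_cast]
    exact div_le_of_le_mul₀ (Nat.cast_nonneg N) (hw0 x) (by linarith)
  have hU : ((hyperfilter ℕ : Ultrafilter ℕ) : Filter ℕ) ≤ atTop := by
    rw [← Nat.cofinite_eq_atTop]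
    exact hyperfilter_le_cofinite
  obtain ⟨φ, hφ, hlim⟩ :=
    exists_integrable_tendsto_setIntegral (hint 1) hf hfb (hyperfilter ℕ)
  refine ⟨φ, hφ, ?_, fun n => ?_⟩
  · have hfint : ∀ N : ℕ, ∫ x, f N x ∂μ = (∫ x, ρ x 0 (N : ℤ) ∂μ) / N := fun N => by
      have hgint : ∀ k : ℕ, ∫ x, g k x ∂μ =
          (∫ x, ρ x 0 ((k + 1 : ℕ) : ℤ) ∂μ) - ∫ x, ρ x 0 (k : ℤ) ∂μ := fun k => by
        simp only [g]
        rw [integral_sub (hint _) (hint1 _)]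
        simp only [hρ, Nat.cast_add, Nat.cast_one]
        rw [(hTmp 1).integral_comp (hemb 1) (fun x => ρ x 0 (k : ℤ))]
      simp only [f]
      rw [integral_div, integral_finsetSum _ fun k _ => hg k]
      simp only [hgint]
      rw [Finset.sum_range_sub (fun k : ℕ => ∫ x, ρ x 0 (k : ℤ) ∂μ)]
      simp [hself]
    have h := hlim Set.univ MeasurableSet.univ
    simp only [setIntegral_univ, hfint] at h
    exact tendsto_nhds_unique h (hA.mono_left hU)
  · let C : X → ℝ := fun x => ∑ j ∈ Finset.range n, 2 * (j : ℝ) * ρ (T j x) 0 1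
    have hC : Integrable C μ :=
      integrable_finsetSum _ fun j _ => (hcomp j (hint 1)).const_mul _
    have hpt : ∀ N : ℕ, 0 < N → ∀ x,
        ∑ j ∈ Finset.range n, f N (T j x) ≤ ρ x 0 n + C x / N := fun N hN x => by
      have hN' : (0 : ℝ) < N := Nat.cast_pos.2 hN
      have hshift : ∀ j : ℕ, ∑ k ∈ Finset.range N, g k (T j x) ≤
          ∑ k ∈ Finset.range N, (ρ x j (k + 1) - ρ x ((j + 1 : ℕ) : ℤ) (k + 1)) +
            2 * j * ρ (T j x) 0 1 := fun j => by
        refine le_trans (le_of_eq ?_) (sum_range_shift_le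
          (F := fun k : ℕ => ρ x j (k + 1) - ρ x ((j + 1 : ℕ) : ℤ) (k + 1)) (fun k => ?_) N j)
        · refine Finset.sum_congr rfl fun k _ => ?_
          simp only [g, hequiv]
          push_cast
          ring_nf
        · rw [hequiv]
          simpa [add_comm] using hdiff x j (k + 1)
      have htel : ∀ k : ℕ, ∑ j ∈ Finset.range n,
          (ρ x j (k + 1) - ρ x ((j + 1 : ℕ) : ℤ) (k + 1)) ≤ ρ x 0 n := fun k => by
        rw [Finset.sum_range_sub' (fun j : ℕ => ρ x j (k + 1))]
        have := htri x 0 n (k + 1)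
        push_cast
        linarith
      have hsum : ∑ j ∈ Finset.range n, ∑ k ∈ Finset.range N, g k (T j x) ≤
          N * ρ x 0 n + C x := by
        refine (Finset.sum_le_sum fun j _ => hshift j).trans ?_
        rw [Finset.sum_add_distrib, Finset.sum_comm]
        refine add_le_add ?_ le_rfl
        exact (Finset.sum_le_card_nsmul _ _ _ fun k _ => htel k).trans (by simp)
      simp only [f]
      rw [← Finset.sum_div, div_le_iff₀ hN', add_mul, div_mul_cancel₀ _ hN'.ne']
      linarith
    refine ae_le_of_forall_setIntegral_le
      (integrable_finsetSum _ fun j _ => hcomp j hφ) (hint n) fun E hE _ => ?_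
    have h1 : Tendsto (fun N => ∫ x in E, ∑ j ∈ Finset.range n, f N (T j x) ∂μ)
        (hyperfilter ℕ) (nhds (∫ x in E, ∑ j ∈ Finset.range n, φ (T j x) ∂μ)) := by
      rw [integral_finsetSum _ fun (j : ℕ) _ => (hcomp j hφ).integrableOn]
      simp only [fun N => integral_finsetSum (μ := μ.restrict E) (Finset.range n)
        fun (j : ℕ) _ => (hcomp j (hf N)).integrableOn, hset]
      exact tendsto_finsetSum _ fun j _ => hlim _ ((hTmp _).measurable hE)
    have h2 : Tendsto (fun N : ℕ => (∫ x in E, ρ x 0 n ∂μ) + (∫ x in E, C x ∂μ) / N)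
        (hyperfilter ℕ) (nhds (∫ x in E, ρ x 0 n ∂μ)) := by
      simpa using (tendsto_const_nhds.add
        (tendsto_const_div_atTop_nhds_zero_nat (∫ x in E, C x ∂μ))).mono_left hU
    refine le_of_tendsto_of_tendsto h1 h2 (hU ?_)
    filter_upwards [eventually_gt_atTop 0] with N hN
    rw [← integral_div, ← integral_add (hint n).integrableOn (hC.div_const _).integrableOn]
    exact integral_mono
      (integrable_finsetSum _ fun j _ => (hcomp j (hf N)).integrableOn)
      ((hint n).integrableOn.add (hC.div_const _).integrableOn) (hpt N hN)

/-- **Kingman decomposition.** For an integrable, strongly measurable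
additive equivariant cocycle `s` with values in a separable reflexive Banach space
`B` over an ergodic `ℤ`-action on a standard probability space, the random
semimetric `ρ_x(m,n) = ‖s_x(m,n)‖` decomposes as a Birkhoff sum of an integrable
function `φ` with `∫φ dμ = A` (the drift) plus a nonnegative subadditive remainder
`r_n` of drift `0`. -/
theorem statement11
    {X B : Type*} [MeasurableSpace X] [StandardBorelSpace X]
    (μ : Measure X) [IsProbabilityMeasure μ]
    [NormedAddCommGroup B] [NormedSpace ℝ B] [CompleteSpace B]
    [TopologicalSpace.SeparableSpace B]
    (hrefl : Function.Surjective (NormedSpace.inclusionInDoubleDual ℝ B))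
    (T : ℤ → X → X)
    (hT0 : T 0 = id)
    (hTadd : ∀ n m : ℤ, T (n + m) = T n ∘ T m)
    (hTmp : ∀ n : ℤ, MeasurePreserving (T n) μ μ)
    (herg : ∀ A : Set X, MeasurableSet A → (∀ n : ℤ, T n ⁻¹' A = A) →
      μ A = 0 ∨ μ A = 1)
    (c : ℤ → X → (B ≃ₗᵢ[ℝ] B))
    (hc0 : ∀ x, c 0 x = LinearIsometryEquiv.refl ℝ B)
    (hcadd : ∀ (n m : ℤ) (x : X) (v : B), c (n + m) x v = c n x (c m (T n x) v))
    (s : X → ℤ → ℤ → B)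
    (hadd : ∀ (x : X) (m k n : ℤ), s x m k + s x k n = s x m n)
    (hequiv : ∀ (x : X) (k m n : ℤ), c k x (s (T k x) m n) = s x (m + k) (n + k))
    (hmeas : ∀ m n : ℤ, StronglyMeasurable fun x => s x m n)
    (hint : ∀ n : ℤ, Integrable (fun x => ‖s x 0 n‖) μ)
    (A : ℝ)
    (hA : Tendsto (fun n : ℕ => (∫ x, ‖s x 0 (n : ℤ)‖ ∂μ) / n) atTop (nhds A)) :
    ∃ φ : X → ℝ, Integrable φ μ ∧ (∫ x, φ x ∂μ) = A ∧
      (∀ n : ℕ, 1 ≤ n → ∀ᵐ x ∂μ,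
        0 ≤ ‖s x 0 (n : ℤ)‖ - ∑ j ∈ Finset.range n, φ (T (j : ℤ) x)) ∧
      (∀ n m : ℕ, 1 ≤ n → 1 ≤ m → ∀ᵐ x ∂μ,
        ‖s x 0 ((n + m : ℕ) : ℤ)‖ - ∑ j ∈ Finset.range (n + m), φ (T (j : ℤ) x) ≤
          (‖s x 0 (n : ℤ)‖ - ∑ j ∈ Finset.range n, φ (T (j : ℤ) x)) +
          (‖s (T (n : ℤ) x) 0 (m : ℤ)‖ -
            ∑ j ∈ Finset.range m, φ (T (j : ℤ) (T (n : ℤ) x)))) ∧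
      Tendsto (fun n : ℕ =>
        (∫ x, (‖s x 0 (n : ℤ)‖ - ∑ j ∈ Finset.range n, φ (T (j : ℤ) x)) ∂μ) / n)
        atTop (nhds 0) := by
  have hself : ∀ x m, s x m m = 0 := fun x m => by simpa using hadd x m m m
  have hequiv' : ∀ x k m n, ‖s (T k x) m n‖ = ‖s x (m + k) (n + k)‖ := fun x k m n => by
    rw [← hequiv, LinearIsometryEquiv.norm_map]
  have htri : ∀ x m k n, ‖s x m n‖ ≤ ‖s x m k‖ + ‖s x k n‖ := fun x m k n => by
    rw [← hadd x m k n]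
    exact norm_add_le _ _
  have hsymm : ∀ x m n, ‖s x m n‖ = ‖s x n m‖ := fun x m n => by
    rw [← norm_neg, neg_eq_of_add_eq_zero_right ((hadd x m n m).trans (hself x m))]
  obtain ⟨φ, hφ, hφA, hle⟩ := exists_birkhoff_minorant hT0 hTadd hTmp
    (ρ := fun x m n => ‖s x m n‖) (fun x m => by simp [hself]) hsymm htri hequiv' hint hA
  refine ⟨φ, hφ, hφA, fun n _ => ?_, fun n m _ _ => ae_of_all _ fun x => ?_, ?_⟩
  · filter_upwards [hle n] with x hx
    exact sub_nonneg.2 hx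
  · have h := htri x 0 n (n + m : ℕ)
    have h' : ‖s (T n x) 0 m‖ = ‖s x n (n + m : ℕ)‖ := by
      rw [hequiv']
      push_cast
      ring_nf
    have hT : ∀ j : ℕ, T j (T n x) = T (n + j : ℕ) x := fun j => by
      rw [add_comm, Nat.cast_add, hTadd]
      rfl
    rw [Finset.sum_range_add, h']
    simp only [hT]
    linarith
  · have hφint : ∀ j : ℤ, ∫ x, φ (T j x) ∂μ = A := fun j => by
      rw [← hφA]
      nth_rewrite 2 [← (hTmp j).map_eq]
      refine (integral_map (hTmp j).aemeasurable ?_).symm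
      rw [(hTmp j).map_eq]
      exact hφ.aestronglyMeasurable
    have hφcomp : ∀ j : ℤ, Integrable (fun x => φ (T j x)) μ := fun j =>
      (hTmp j).integrable_comp_of_integrable hφ
    have h : Tendsto (fun n : ℕ => (∫ x, ‖s x 0 (n : ℤ)‖ ∂μ) / n - A) atTop (nhds 0) := by
      simpa using hA.sub_const A
    refine h.congr' ?_
    filter_upwards [eventually_gt_atTop 0] with n hn
    have hn' : (n : ℝ) ≠ 0 := Nat.cast_ne_zero.2 hn.ne'
    rw [integral_sub (hint n) (integrable_finsetSum _ fun (j : ℕ) _ => hφcomp j),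
      integral_finsetSum _ fun (j : ℕ) _ => hφcomp j]
    simp only [hφint, Finset.sum_const, Finset.card_range, nsmul_eq_mul]
    field_simp
end

section
/- Let H be a real or complex Hilbert space, let U : H → H be a unitary operator, let P be the orthogonal projection of H onto the closed subspace of U-invariant vectors {g ∈ H : U g = g}, and let f ∈ H. Then the Fejér averages (1/n²)·Σ_{k=−n}^{n} (n − |k|)·U^k f converge in norm to P f as n → ∞. -/
open Filter

/-- Enlarging a symmetric integer interval by one adds its two endpoints. -/
theorem sum_Icc_neg_succ {M : Type*} [AddCommGroup M] (φ : ℤ → M) (n : ℕ) :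
    ∑ k ∈ Finset.Icc (-((n + 1 : ℕ) : ℤ)) ((n + 1 : ℕ) : ℤ), φ k =
      (∑ k ∈ Finset.Icc (-(n : ℤ)) (n : ℤ), φ k) + (φ (n + 1) + φ (-(n + 1))) := by
  rw [Nat.cast_succ, Finset.Icc_succ_succ, Finset.sum_union (by simp), Finset.sum_pair (by lia),
    add_comm (φ _)]

theorem sum_Icc_neg_eq_sum_range {M : Type*} [AddCommGroup M] (φ : ℤ → M) (n : ℕ) :
    ∑ k ∈ Finset.Icc (-(n : ℤ)) (n : ℤ), φ k =
      (∑ i ∈ Finset.range n, (φ (n - i) + φ (i - n))) + φ 0 := by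
  induction n with
  | zero => simp
  | succ n ih =>
    rw [sum_Icc_neg_succ, ih, Finset.sum_range_succ']
    have h (i : ℕ) : φ ((n + 1 : ℕ) - (i + 1 : ℕ)) + φ ((i + 1 : ℕ) - (n + 1 : ℕ)) =
        φ (n - i) + φ (i - n) := by
      congr 2 <;> push_cast <;> ring
    simp only [h]
    have h' : ((0 : ℕ) : ℤ) - ((n + 1 : ℕ) : ℤ) = -(n + 1) := by push_cast; ring
    rw [h']
    push_cast
    rw [sub_zero]
    abel

/-- Counting the pairs in a square by their difference gives the Fejér weights. -/
theorem sum_Icc_sub_abs_zsmul {M : Type*} [AddCommGroup M] (φ : ℤ → M) (n : ℕ) :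
    ∑ k ∈ Finset.Icc (-(n : ℤ)) (n : ℤ), ((n : ℤ) - |k|) • φ k =
      ∑ i ∈ Finset.range n, ∑ j ∈ Finset.range n, φ ((i : ℤ) - j) := by
  induction n with
  | zero => simp
  | succ n ih =>
    rw [sum_Icc_neg_succ]
    have h₁ : |((n : ℤ) + 1)| = n + 1 := abs_of_nonneg (by positivity)
    have h₂ (k : ℤ) : (((n + 1 : ℕ) : ℤ) - |k|) • φ k = ((n : ℤ) - |k|) • φ k + φ k := by
      rw [← add_one_zsmul]
      congr 1
      push_cast
      ring
    rw [abs_neg, h₁]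
    simp only [Nat.cast_succ, sub_self, zero_smul, add_zero]
    simp only [← Nat.cast_succ, h₂, Finset.sum_add_distrib, ih, Finset.sum_range_succ,
      sum_Icc_neg_eq_sum_range]
    rw [sub_self]
    abel

theorem LinearIsometryEquiv.coe_pow {R E : Type*} [Semiring R] [SeminormedAddCommGroup E]
    [Module R E] (U : E ≃ₗᵢ[R] E) (n : ℕ) : ⇑(U ^ n) = U^[n] :=
  hom_coe_pow _ rfl (fun _ _ ↦ rfl) _ _

/-- The Fejér average is the composition of the Birkhoff averages of `U` and `U⁻¹`. -/
theorem sum_fejer_eq_birkhoffAverage {𝕜 E : Type*} [RCLike 𝕜] [NormedAddCommGroup E]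
    [NormedSpace 𝕜 E] (U : E ≃ₗᵢ[𝕜] E) (n : ℕ) (x : E) :
    ∑ k ∈ Finset.Icc (-(n : ℤ)) (n : ℤ),
        ((((n : ℤ) - |k| : ℤ) : 𝕜) / (n : 𝕜) ^ 2) • (U ^ k) x =
      birkhoffAverage 𝕜 U.symm id n (birkhoffAverage 𝕜 U id n x) := by
  have h (k : ℤ) : ((((n : ℤ) - |k| : ℤ) : 𝕜) / (n : 𝕜) ^ 2) • (U ^ k) x =
      ((n : 𝕜)⁻¹ * (n : 𝕜)⁻¹) • (((n : ℤ) - |k|) • (U ^ k) x) := by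
    rw [← Int.cast_smul_eq_zsmul 𝕜, smul_smul]
    congr 1
    ring
  have hpow (i j : ℕ) : (U ^ ((i : ℤ) - j)) x = (U.symm ^ j) ((U ^ i) x) := by
    rw [sub_eq_add_neg, add_comm, zpow_add, zpow_neg, zpow_natCast, zpow_natCast, ← inv_pow]
    rfl
  simp only [h, ← Finset.smul_sum, sum_Icc_sub_abs_zsmul (fun k ↦ (U ^ k) x), hpow]
  simp only [birkhoffAverage, birkhoffSum, id, ← LinearIsometryEquiv.coe_pow,
    map_smul, map_sum, ← Finset.smul_sum, smul_smul]
  rw [Finset.sum_comm]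

/-- Birkhoff averages of a linear isometry are contractions. -/
theorem LinearIsometryEquiv.norm_birkhoffAverage_sub_le {𝕜 E : Type*} [RCLike 𝕜]
    [NormedAddCommGroup E] [NormedSpace 𝕜 E] (U : E ≃ₗᵢ[𝕜] E) (n : ℕ) (x y : E) :
    ‖birkhoffAverage 𝕜 U id n x - birkhoffAverage 𝕜 U id n y‖ ≤ ‖x - y‖ := by
  have h := dist_birkhoffAverage_birkhoffAverage_le 𝕜 U id n x y
  have hd (k : ℕ) : dist (id (U^[k] x)) (id (U^[k] y)) = ‖x - y‖ := by
    rw [id, id, ← LinearIsometryEquiv.coe_pow, LinearIsometryEquiv.dist_map, dist_eq_norm]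
  simp only [hd, Finset.sum_const, Finset.card_range, nsmul_eq_mul, dist_eq_norm] at h
  refine h.trans ?_
  rcases n.eq_zero_or_pos with rfl | hn
  · simp
  · rw [mul_div_cancel_left₀]
    positivity

/-- For a unitary operator `U` on a Hilbert space `H` (real or
complex, i.e. over `𝕜` with `RCLike 𝕜`) with `P` the orthogonal projection onto the
`U`-invariant vectors, the Fejér averages `(1/n²) Σ_{k=-n}^{n} (n-|k|) U^k f`
converge in norm to `P f`. -/
theorem statement14
    {𝕜 H : Type*} [RCLike 𝕜] [NormedAddCommGroup H] [InnerProductSpace 𝕜 H]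
    [CompleteSpace H]
    (U : H ≃ₗᵢ[𝕜] H)
    (P : H →L[𝕜] H)
    (hPfix : ∀ v : H, U (P v) = P v)
    (hPorth : ∀ v w : H, U w = w → @inner 𝕜 _ _ (v - P v) w = 0)
    (f : H) :
    Tendsto (fun n : ℕ =>
        ∑ k ∈ Finset.Icc (-(n : ℤ)) (n : ℤ),
          ((((n : ℤ) - |k| : ℤ) : 𝕜) / ((n : 𝕜)) ^ 2) • (U ^ k) f)
      atTop (nhds (P f)) := by
  have hP : ((U : H →L[𝕜] H).eqLocus (1 : H →L[𝕜] H)).starProjection f = P f :=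
    Submodule.eq_starProjection_of_mem_of_inner_eq_zero (hPfix f) fun w hw ↦ hPorth f w hw
  have hlim : Tendsto (birkhoffAverage 𝕜 U id · f) atTop (nhds (P f)) := by
    rw [← hP]
    exact ContinuousLinearMap.tendsto_birkhoffAverage_orthogonalProjection
      (U : H →L[𝕜] H) U.toLinearIsometry.norm_toContinuousLinearMap_le f
  have hfix : Function.IsFixedPt U.symm (P f) := by
    rw [Function.IsFixedPt, LinearIsometryEquiv.symm_apply_eq, hPfix]
  simp only [sum_fejer_eq_birkhoffAverage]
  rw [tendsto_iff_norm_sub_tendsto_zero] at hlim ⊢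
  refine squeeze_zero' (.of_forall fun _ ↦ norm_nonneg _) ?_ hlim
  filter_upwards [eventually_ne_atTop 0] with n hn
  have hn' : (n : 𝕜) ≠ 0 := Nat.cast_ne_zero.2 hn
  have := U.symm.norm_birkhoffAverage_sub_le (𝕜 := 𝕜) n (birkhoffAverage 𝕜 U id n f) (P f)
  rwa [hfix.birkhoffAverage_eq 𝕜 id hn', id] at this
end
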